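/- arXiv:2603.09257 — 2 statements merged into one kernel-verified Lean document; each statement's English description precedes it below -/
import Mathlib

section
/- Let A be a symmetric real n×n matrix and let u ∈ ℝ^n be nonzero with A·u = u. Suppose ρ ≥ 0 satisfies ‖A·h‖ ≤ ρ·‖h‖ for every h ∈ ℝ^n with ⟨u, h⟩ = 0, and let P := I − u·uᵀ/‖u‖². Let X be a real n×F matrix, ℓ ∈ ℕ, and let z_i := (A^ℓ·X)_{i·} ∈ ℝ^F denote the i-th row of A^ℓ·X. Then for all indices i, j ∈ {1,…,n}: ‖z_i − z_j‖ ≤ (‖X‖_F/‖u‖)·|u_i − u_j| + √2·ρ^ℓ·‖P·X‖_F. -/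
open scoped BigOperators

/-- Euclidean norm of a vector. -/
noncomputable def euclNorm {n : ℕ} (v : Fin n → ℝ) : ℝ := Real.sqrt (∑ i, (v i) ^ 2)

/-- Frobenius norm of a real matrix. -/
noncomputable def frobNorm {n F : ℕ} (M : Matrix (Fin n) (Fin F) ℝ) : ℝ :=
  Real.sqrt (∑ i, ∑ j, (M i j) ^ 2)

lemma euclNorm_eq {n : ℕ} (v : Fin n → ℝ) : euclNorm v = ‖WithLp.toLp 2 v‖ := by
  simp [euclNorm, EuclideanSpace.norm_eq]

lemma euclNorm_sq {n : ℕ} (v : Fin n → ℝ) : euclNorm v ^ 2 = ∑ i, (v i) ^ 2 :=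
  Real.sq_sqrt (Finset.sum_nonneg fun _ _ => sq_nonneg _)

lemma euclNorm_nonneg {n : ℕ} (v : Fin n → ℝ) : 0 ≤ euclNorm v := Real.sqrt_nonneg _

lemma euclNorm_add {n : ℕ} (v w : Fin n → ℝ) : euclNorm (v + w) ≤ euclNorm v + euclNorm w := by
  simp only [euclNorm_eq, WithLp.toLp_add]
  exact norm_add_le _ _

lemma euclNorm_smul {n : ℕ} (a : ℝ) (v : Fin n → ℝ) : euclNorm (a • v) = |a| * euclNorm v := by
  simp only [euclNorm_eq, WithLp.toLp_smul, norm_smul, Real.norm_eq_abs]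

lemma frobNorm_sq {n F : ℕ} (M : Matrix (Fin n) (Fin F) ℝ) :
    frobNorm M ^ 2 = ∑ i, ∑ j, (M i j) ^ 2 :=
  Real.sq_sqrt (Finset.sum_nonneg fun _ _ => Finset.sum_nonneg fun _ _ => sq_nonneg _)

lemma frobNorm_nonneg {n F : ℕ} (M : Matrix (Fin n) (Fin F) ℝ) : 0 ≤ frobNorm M :=
  Real.sqrt_nonneg _

lemma pow_bound {n : ℕ} (A : Matrix (Fin n) (Fin n) ℝ) (hsym : A.IsSymm)
    (u : Fin n → ℝ) (hAu : A.mulVec u = u) (ρ : ℝ) (hρ0 : 0 ≤ ρ)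
    (hρ : ∀ h : Fin n → ℝ, (∑ i, u i * h i) = 0 → euclNorm (A.mulVec h) ≤ ρ * euclNorm h)
    (h : Fin n → ℝ) (hh : (∑ i, u i * h i) = 0) (l : ℕ) :
    (∑ i, u i * ((A ^ l).mulVec h) i) = 0 ∧
      euclNorm ((A ^ l).mulVec h) ≤ ρ ^ l * euclNorm h := by
  induction l with
  | zero => simpa using hh
  | succ k ih =>
    obtain ⟨h1, h2⟩ := ih
    have e : (A ^ (k + 1)).mulVec h = A.mulVec ((A ^ k).mulVec h) := by
      rw [pow_succ', Matrix.mulVec_mulVec]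
    rw [e]
    constructor
    · change u ⬝ᵥ (A.mulVec ((A ^ k).mulVec h)) = 0
      rw [Matrix.dotProduct_mulVec, ← Matrix.mulVec_transpose, hsym.eq, hAu]
      exact h1
    · calc _ ≤ ρ * euclNorm ((A ^ k).mulVec h) := hρ _ h1
        _ ≤ ρ * (ρ ^ k * euclNorm h) := by gcongr
        _ = _ := by ring

lemma pow_fix {n : ℕ} (A : Matrix (Fin n) (Fin n) ℝ)
    (u : Fin n → ℝ) (hAu : A.mulVec u = u) (l : ℕ) : (A ^ l).mulVec u = u := by
  induction l with
  | zero => simp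
  | succ k ih => rw [pow_succ, ← Matrix.mulVec_mulVec, hAu, ih]

lemma le_of_sq_le_sq_aux {a b : ℝ} (h : a ^ 2 ≤ b ^ 2) (hb : 0 ≤ b) : a ≤ b :=
  abs_le_of_sq_le_sq' h hb |>.2

theorem stmt11 {n F : ℕ} (A : Matrix (Fin n) (Fin n) ℝ) (hsym : A.IsSymm)
    (u : Fin n → ℝ) (hu : u ≠ 0) (hAu : A.mulVec u = u)
    (ρ : ℝ) (hρ0 : 0 ≤ ρ)
    (hρ : ∀ h : Fin n → ℝ, (∑ i, u i * h i) = 0 → euclNorm (A.mulVec h) ≤ ρ * euclNorm h)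
    (P : Matrix (Fin n) (Fin n) ℝ)
    (hP : P = 1 - ((euclNorm u) ^ 2)⁻¹ • Matrix.vecMulVec u u)
    (X : Matrix (Fin n) (Fin F) ℝ) (ℓ : ℕ)
    (z : Fin n → (Fin F → ℝ)) (hz : ∀ i, z i = (A ^ ℓ * X) i)
    (i j : Fin n) :
    euclNorm (z i - z j) ≤
      (frobNorm X / euclNorm u) * |u i - u j| + Real.sqrt 2 * ρ ^ ℓ * frobNorm (P * X) := by
  have hNpos : 0 < ∑ i, u i ^ 2 := by
    obtain ⟨k, hk⟩ := Function.ne_iff.mp hu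
    have hk' : u k ≠ 0 := hk
    have : u k ^ 2 ≤ ∑ i, u i ^ 2 :=
      Finset.single_le_sum (f := fun i => u i ^ 2) (fun _ _ => sq_nonneg _) (Finset.mem_univ k)
    have : 0 < u k ^ 2 := by positivity
    linarith
  have hupos : 0 < euclNorm u := Real.sqrt_pos.mpr hNpos
  have hN := euclNorm_sq u
  set N := ∑ i, u i ^ 2 with hNdef
  let c : Fin F → ℝ := fun k => (∑ i, u i * X i k) / N
  have hPX : ∀ a k, (P * X) a k = X a k - u a * c k := by
    intro a k
    rw [hP, hN, Matrix.sub_mul, Matrix.one_mul, Matrix.smul_mul]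
    simp only [Matrix.sub_apply, Matrix.smul_apply, Matrix.mul_apply, Matrix.vecMulVec_apply,
      smul_eq_mul, c, mul_assoc]
    rw [← Finset.mul_sum]
    ring
  have horth : ∀ k, ∑ a, u a * (P * X) a k = 0 := by
    intro k
    simp only [hPX, mul_sub, Finset.sum_sub_distrib, ← mul_assoc]
    rw [← Finset.sum_mul]
    simp only [← pow_two, ← hNdef, c]
    field_simp
    ring
  set W := A ^ ℓ * (P * X) with hW
  have hWcol : ∀ k, (fun a => W a k) = (A ^ ℓ).mulVec (fun a => (P * X) a k) := by
    intro k; ext a; rfl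
  have hWb : frobNorm W ≤ ρ ^ ℓ * frobNorm (P * X) := by
    apply le_of_sq_le_sq_aux _ (by have := frobNorm_nonneg (P * X); positivity)
    rw [mul_pow, frobNorm_sq, frobNorm_sq, Finset.sum_comm (f := fun a k => W a k ^ 2),
      Finset.sum_comm (f := fun a k => (P * X) a k ^ 2), Finset.mul_sum]
    apply Finset.sum_le_sum
    intro k _
    have := (pow_bound A hsym u hAu ρ hρ0 hρ _ (horth k) ℓ).2
    rw [← hWcol] at this
    have := pow_le_pow_left₀ (euclNorm_nonneg _) this 2
    rwa [mul_pow, euclNorm_sq, euclNorm_sq] at this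
  have hdec : ∀ a k, (A ^ ℓ * X) a k = u a * c k + W a k := by
    intro a k
    have e : (fun b => X b k) = c k • u + fun b => (P * X) b k := by
      ext b; simp [hPX]; ring
    have : (A ^ ℓ * X) a k = ((A ^ ℓ).mulVec (fun b => X b k)) a := rfl
    rw [this, e, Matrix.mulVec_add, Matrix.mulVec_smul, pow_fix A u hAu, ← hWcol]
    simp; ring
  have hzz : z i - z j = (u i - u j) • c + (W i - W j) := by
    ext k
    simp [hz, hdec]; ring
  have hc : euclNorm c ≤ frobNorm X / euclNorm u := by
    apply le_of_sq_le_sq_aux _ (div_nonneg (frobNorm_nonneg _) hupos.le)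
    rw [div_pow, hN, euclNorm_sq, frobNorm_sq, Finset.sum_comm, Finset.sum_div]
    apply Finset.sum_le_sum
    intro k _
    have := Finset.sum_mul_sq_le_sq_mul_sq Finset.univ u (fun i => X i k)
    simp only [c, div_pow]
    rw [div_le_div_iff₀ (by positivity) hNpos]
    nlinarith
  have hd : euclNorm (W i - W j) ≤ Real.sqrt 2 * frobNorm W := by
    apply le_of_sq_le_sq_aux _ (mul_nonneg (Real.sqrt_nonneg _) (frobNorm_nonneg _))
    rw [mul_pow, Real.sq_sqrt (by norm_num), euclNorm_sq, frobNorm_sq]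
    by_cases hij : i = j
    · subst hij
      simp only [sub_self, Pi.zero_apply]
      have : 0 ≤ ∑ i, ∑ j, W i j ^ 2 :=
        Finset.sum_nonneg fun _ _ => Finset.sum_nonneg fun _ _ => sq_nonneg _
      simp only [ne_eq, OfNat.ofNat_ne_zero, not_false_eq_true, zero_pow, Finset.sum_const_zero]
      linarith
    · have h1 : ∑ a ∈ ({i, j} : Finset (Fin n)), ∑ k, W a k ^ 2 ≤ ∑ a, ∑ k, W a k ^ 2 :=
        Finset.sum_le_sum_of_subset_of_nonneg (Finset.subset_univ _)
          fun _ _ _ => Finset.sum_nonneg fun _ _ => sq_nonneg _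
      rw [Finset.sum_pair hij, ← Finset.sum_add_distrib] at h1
      refine le_trans ?_ (mul_le_mul_of_nonneg_left h1 (by norm_num))
      rw [Finset.mul_sum]
      apply Finset.sum_le_sum
      intro k _
      simp only [Pi.sub_apply]
      nlinarith [sq_nonneg (W i k + W j k)]
  rw [hzz]
  calc _ ≤ euclNorm ((u i - u j) • c) + euclNorm (W i - W j) := euclNorm_add _ _
    _ ≤ |u i - u j| * (frobNorm X / euclNorm u)
        + Real.sqrt 2 * (ρ ^ ℓ * frobNorm (P * X)) := by
      rw [euclNorm_smul]
      exact add_le_add (mul_le_mul_of_nonneg_left hc (abs_nonneg _))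
        (hd.trans (mul_le_mul_of_nonneg_left hWb (Real.sqrt_nonneg _)))
    _ = _ := by ring
end

section
/- Let Â be a symmetric real n×n matrix with spectral norm ‖Â‖₂ ≤ 1, and let u ∈ ℝ^n be nonzero with nonnegative entries and Â·u = u. Suppose ρ ≥ 0 satisfies ‖Â·h‖ ≤ ρ·‖h‖ for every h ∈ ℝ^n with ⟨u, h⟩ = 0, and let P := I − u·uᵀ/‖u‖². Let β ≥ 0 and let W^{(0)}, W^{(1)}, … be real matrices (of any compatible dimensions) with ‖W^{(t)}‖₂ ≤ β for every t. Let X be a real n×F₀ matrix, define X^{(0)} := X and X^{(t+1)} := ReLU(Â·X^{(t)}·W^{(t)}) for all t ≥ 0 (ReLU applied entrywise), and let z_i^{(ℓ)} := (X^{(ℓ)})_{i·} denote the i-th row of X^{(ℓ)}. Then for every ℓ ∈ ℕ and all indices i, j ∈ {1,…,n}: ‖z_i^{(ℓ)} − z_j^{(ℓ)}‖ ≤ β^ℓ·(‖X‖_F/‖u‖)·|u_i − u_j| + √2·(β·ρ)^ℓ·‖P·X‖_F. -/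
open scoped BigOperators

/-- GCN iterates `X^{(0)} = X`, `X^{(t+1)} = ReLU(Â · X^{(t)} · W^{(t)})`. -/
noncomputable def gcnIter {n : ℕ} (Fdim : ℕ → ℕ) (Ahat : Matrix (Fin n) (Fin n) ℝ)
    (W : ∀ t : ℕ, Matrix (Fin (Fdim t)) (Fin (Fdim (t + 1))) ℝ)
    (X : Matrix (Fin n) (Fin (Fdim 0)) ℝ) : ∀ t : ℕ, Matrix (Fin n) (Fin (Fdim t)) ℝ
  | 0 => X
  | t + 1 => (Ahat * gcnIter Fdim Ahat W X t * W t).map (fun a => max a 0)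

/-- Squared Frobenius norm. -/
noncomputable def fsq {n F : ℕ} (M : Matrix (Fin n) (Fin F) ℝ) : ℝ := ∑ i, ∑ j, (M i j) ^ 2

lemma fsq_nonneg {n F : ℕ} (M : Matrix (Fin n) (Fin F) ℝ) : 0 ≤ fsq M := by
  unfold fsq; positivity

lemma frob_sq {n F : ℕ} (M : Matrix (Fin n) (Fin F) ℝ) : frobNorm M ^ 2 = fsq M :=
  Real.sq_sqrt (fsq_nonneg M)

lemma sq_of_euclNorm {m k : ℕ} (v : Fin m → ℝ) (w : Fin k → ℝ) (c : ℝ)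
    (h : euclNorm v ≤ c * euclNorm w) : ∑ i, v i ^ 2 ≤ c ^ 2 * ∑ i, w i ^ 2 := by
  have h1 : euclNorm v ^ 2 = ∑ i, v i ^ 2 := Real.sq_sqrt (by positivity)
  have h2 : euclNorm w ^ 2 = ∑ i, w i ^ 2 := Real.sq_sqrt (by positivity)
  have h0 : 0 ≤ euclNorm v := Real.sqrt_nonneg _
  rw [← h1, ← h2, ← mul_pow]
  exact pow_le_pow_left₀ h0 h 2

lemma transpose_bound {m k : ℕ} (W : Matrix (Fin m) (Fin k) ℝ) (b : ℝ)
    (hW : ∀ v : Fin k → ℝ, ∑ i, (W.mulVec v) i ^ 2 ≤ b ^ 2 * ∑ i, v i ^ 2)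
    (r : Fin m → ℝ) :
    ∑ j, (∑ i, r i * W i j) ^ 2 ≤ b ^ 2 * ∑ i, r i ^ 2 := by
  set w : Fin k → ℝ := fun j => ∑ i, r i * W i j with hw
  have e : ∑ j, w j ^ 2 = ∑ i, r i * (W.mulVec w) i := by
    simp only [Matrix.mulVec, dotProduct, Finset.mul_sum]
    rw [Finset.sum_comm]
    refine Finset.sum_congr rfl fun j _ => ?_
    rw [sq]
    conv_lhs => rw [hw]
    simp only [Finset.sum_mul]
    exact Finset.sum_congr rfl fun i _ => by rw [hw]; ring
  have cs := Finset.sum_mul_sq_le_sq_mul_sq Finset.univ r (W.mulVec w)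
  rw [← e] at cs
  have hb := hW w
  have hr : 0 ≤ ∑ i, r i ^ 2 := by positivity
  have hs : 0 ≤ ∑ j, w j ^ 2 := by positivity
  change ∑ j, w j ^ 2 ≤ _
  rcases hs.eq_or_lt with h | h
  · rw [← h]; positivity
  · have := mul_le_mul_of_nonneg_left hb hr
    refine le_of_mul_le_mul_right ?_ h
    nlinarith

lemma fsq_mul_right {n m k : ℕ} (M : Matrix (Fin n) (Fin m) ℝ) (W : Matrix (Fin m) (Fin k) ℝ)
    (b : ℝ) (hW : ∀ v : Fin k → ℝ, ∑ i, (W.mulVec v) i ^ 2 ≤ b ^ 2 * ∑ i, v i ^ 2) :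
    fsq (M * W) ≤ b ^ 2 * fsq M := by
  unfold fsq
  rw [Finset.mul_sum]
  refine Finset.sum_le_sum fun i _ => ?_
  simp only [Matrix.mul_apply]
  exact transpose_bound W b hW (M i)

lemma fsq_mul_left {n m : ℕ} (A : Matrix (Fin n) (Fin n) ℝ) (M : Matrix (Fin n) (Fin m) ℝ)
    (b : ℝ) (hA : ∀ k, ∑ i, (A.mulVec fun l => M l k) i ^ 2 ≤ b ^ 2 * ∑ i, M i k ^ 2) :
    fsq (A * M) ≤ b ^ 2 * fsq M := by
  unfold fsq
  rw [Finset.sum_comm, Finset.sum_comm (f := fun i j => M i j ^ 2), Finset.mul_sum]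
  refine Finset.sum_le_sum fun k _ => ?_
  exact hA k

lemma relu_lip (a b : ℝ) : (max a 0 - max b 0) ^ 2 ≤ (a - b) ^ 2 :=
  sq_le_sq.mpr (abs_max_sub_max_le_abs a b 0)

lemma relu_sq (a : ℝ) : (max a 0) ^ 2 ≤ a ^ 2 := by
  simpa using relu_lip a 0

lemma proj_min {n : ℕ} (u y : Fin n → ℝ) (N c : ℝ) (hN : 0 < N) (hu : ∑ i, u i ^ 2 = N) :
    ∑ i, (y i - (∑ l, u l * y l) / N * u i) ^ 2 ≤ ∑ i, (y i - c * u i) ^ 2 := by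
  have key : ∀ d : ℝ, ∑ i, (y i - d * u i) ^ 2
      = ∑ i, y i ^ 2 - 2 * d * (∑ l, u l * y l) + d ^ 2 * N := by
    intro d
    rw [← hu, Finset.mul_sum, Finset.mul_sum, ← Finset.sum_sub_distrib, ← Finset.sum_add_distrib]
    exact Finset.sum_congr rfl fun i _ => by ring
  rw [key, key]
  set s := ∑ l, u l * y l
  have h1 : s = s / N * N := by field_simp
  generalize s / N = q at h1 ⊢
  rw [h1]
  nlinarith [mul_nonneg hN.le (sq_nonneg (c - q))]

lemma relu_proj {n : ℕ} (u y : Fin n → ℝ) (N : ℝ) (hN : 0 < N) (hu : ∑ i, u i ^ 2 = N)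
    (hu0 : ∀ i, 0 ≤ u i) :
    ∑ i, (max (y i) 0 - (∑ l, u l * max (y l) 0) / N * u i) ^ 2
      ≤ ∑ i, (y i - (∑ l, u l * y l) / N * u i) ^ 2 := by
  refine (proj_min u (fun i => max (y i) 0) N (max ((∑ l, u l * y l) / N) 0) hN hu).trans ?_
  refine Finset.sum_le_sum fun i _ => ?_
  rw [max_mul_of_nonneg _ _ (hu0 i), zero_mul]
  exact relu_lip _ _

theorem stmt15 {n : ℕ} (Ahat : Matrix (Fin n) (Fin n) ℝ) (hsym : Ahat.IsSymm)
    (hAhat : ∀ v : Fin n → ℝ, euclNorm (Ahat.mulVec v) ≤ euclNorm v)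
    (u : Fin n → ℝ) (hu : u ≠ 0) (hu0 : ∀ i, 0 ≤ u i) (hAu : Ahat.mulVec u = u)
    (ρ : ℝ) (hρ0 : 0 ≤ ρ)
    (hρ : ∀ h : Fin n → ℝ, (∑ i, u i * h i) = 0 →
      euclNorm (Ahat.mulVec h) ≤ ρ * euclNorm h)
    (P : Matrix (Fin n) (Fin n) ℝ)
    (hP : P = 1 - ((euclNorm u) ^ 2)⁻¹ • Matrix.vecMulVec u u)
    (β : ℝ) (hβ : 0 ≤ β) (Fdim : ℕ → ℕ)
    (W : ∀ t : ℕ, Matrix (Fin (Fdim t)) (Fin (Fdim (t + 1))) ℝ)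
    (hW : ∀ t : ℕ, ∀ v : Fin (Fdim (t + 1)) → ℝ,
      euclNorm ((W t).mulVec v) ≤ β * euclNorm v)
    (X : Matrix (Fin n) (Fin (Fdim 0)) ℝ) (ℓ : ℕ) (i j : Fin n) :
    euclNorm (gcnIter Fdim Ahat W X ℓ i - gcnIter Fdim Ahat W X ℓ j) ≤
      β ^ ℓ * (frobNorm X / euclNorm u) * |u i - u j|
        + Real.sqrt 2 * (β * ρ) ^ ℓ * frobNorm (P * X) := by
  have hN' : euclNorm u ^ 2 = ∑ i, u i ^ 2 := Real.sq_sqrt (by positivity)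
  set N : ℝ := euclNorm u ^ 2 with hNdef
  have hun : 0 ≤ euclNorm u := Real.sqrt_nonneg _
  have hN : 0 < N := by
    obtain ⟨k, hk⟩ := Function.ne_iff.mp hu
    rw [hN']
    exact Finset.sum_pos' (fun i _ => sq_nonneg _) ⟨k, Finset.mem_univ _, by
      have : u k ≠ 0 := hk
      positivity⟩
  have hupos : 0 < euclNorm u := by
    rcases hun.eq_or_lt with h | h
    · rw [hNdef, ← h] at hN; norm_num at hN
    · exact h
  have PY : ∀ {F : ℕ} (Y : Matrix (Fin n) (Fin F) ℝ) (a : Fin n) (k : Fin F),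
      (P * Y) a k = Y a k - (∑ l, u l * Y l k) / N * u a := by
    intro F Y a k
    rw [hP, Matrix.sub_mul, Matrix.one_mul, Matrix.sub_apply, Matrix.smul_mul, Matrix.smul_apply,
      Matrix.mul_apply]
    simp only [Matrix.vecMulVec_apply, smul_eq_mul, mul_assoc]
    rw [← Finset.mul_sum]
    ring
  have comm : P * Ahat = Ahat * P := by
    rw [hP, Matrix.sub_mul, Matrix.mul_sub, Matrix.one_mul, Matrix.mul_one, Matrix.smul_mul,
      Matrix.mul_smul, Matrix.vecMulVec_mul, Matrix.mul_vecMulVec, hAu]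
    rw [← Matrix.mulVec_transpose, hsym.eq, hAu]
  have orth : ∀ {F : ℕ} (Y : Matrix (Fin n) (Fin F) ℝ) (k : Fin F),
      ∑ a, u a * (P * Y) a k = 0 := by
    intro F Y k
    simp only [PY, mul_sub, Finset.sum_sub_distrib]
    have : ∑ x, u x * ((∑ l, u l * Y l k) / N * u x) = (∑ l, u l * Y l k) / N * N := by
      conv_rhs => rw [hN', Finset.mul_sum]
      rw [← hN']
      exact Finset.sum_congr rfl fun i _ => by ring
    rw [this]; field_simp; simp
  have hW2 : ∀ t, ∀ v : Fin (Fdim (t + 1)) → ℝ,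
      ∑ i, ((W t).mulVec v) i ^ 2 ≤ β ^ 2 * ∑ i, v i ^ 2 :=
    fun t v => sq_of_euclNorm _ _ _ (hW t v)
  set Z := gcnIter Fdim Ahat W X with hZ
  have Z0 : Z 0 = X := rfl
  have Zs : ∀ t, Z (t + 1) = (Ahat * Z t * W t).map (fun a => max a 0) := fun t => rfl
  have b1 : ∀ t, fsq (Z t) ≤ (β ^ t) ^ 2 * fsq X := by
    intro t
    induction t with
    | zero => simp [Z0]
    | succ t ih =>
      have h1 : fsq (Z (t + 1)) ≤ fsq (Ahat * Z t * W t) := by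
        rw [Zs]
        exact Finset.sum_le_sum fun a _ => Finset.sum_le_sum fun k _ => relu_sq _
      have h2 := fsq_mul_right (Ahat * Z t) (W t) β (hW2 t)
      have h3 := fsq_mul_left Ahat (Z t) 1 fun k => by
        refine sq_of_euclNorm _ _ _ ?_
        rw [one_mul]; exact hAhat _
      have h4 : fsq (Ahat * Z t) ≤ (β ^ t) ^ 2 * fsq X := by linarith
      have h5 := mul_le_mul_of_nonneg_left h4 (sq_nonneg β)
      calc _ ≤ _ := h1.trans (h2.trans h5)
        _ = _ := by ring
  have b2 : ∀ t, fsq (P * Z t) ≤ ((β * ρ) ^ t) ^ 2 * fsq (P * X) := by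
    intro t
    induction t with
    | zero => simp [Z0]
    | succ t ih =>
      have h1 : fsq (P * Z (t + 1)) ≤ fsq (P * (Ahat * Z t * W t)) := by
        rw [Zs]
        unfold fsq
        rw [Finset.sum_comm, Finset.sum_comm (f := fun i j => (P * (Ahat * Z t * W t)) i j ^ 2)]
        refine Finset.sum_le_sum fun k _ => ?_
        simp only [PY, Matrix.map_apply]
        exact relu_proj u (fun a => (Ahat * Z t * W t) a k) N hN hN'.symm hu0
      have e : P * (Ahat * Z t * W t) = Ahat * (P * Z t) * W t := by
        rw [← Matrix.mul_assoc, ← Matrix.mul_assoc, comm, Matrix.mul_assoc Ahat]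
      rw [e] at h1
      have h2 := fsq_mul_right (Ahat * (P * Z t)) (W t) β (hW2 t)
      have h3 := fsq_mul_left Ahat (P * Z t) ρ fun k =>
        sq_of_euclNorm _ _ _ (hρ _ (orth (Z t) k))
      have h4 := h3.trans (mul_le_mul_of_nonneg_left ih (sq_nonneg ρ))
      have h5 := mul_le_mul_of_nonneg_left h4 (sq_nonneg β)
      calc _ ≤ _ := h1.trans (h2.trans h5)
        _ = _ := by ring
  have f1 : frobNorm (Z ℓ) ≤ β ^ ℓ * frobNorm X := by
    refine Real.sqrt_le_iff.mpr ⟨mul_nonneg (by positivity) (Real.sqrt_nonneg _), ?_⟩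
    rw [mul_pow, frob_sq]
    exact b1 ℓ
  have f2 : frobNorm (P * Z ℓ) ≤ (β * ρ) ^ ℓ * frobNorm (P * X) := by
    refine Real.sqrt_le_iff.mpr ⟨mul_nonneg (by positivity) (Real.sqrt_nonneg _), ?_⟩
    rw [mul_pow, frob_sq]
    exact b2 ℓ
  -- mean vector
  set m : Fin (Fdim ℓ) → ℝ := fun k => (∑ l, u l * Z ℓ l k) / N with hm
  have hmn : euclNorm m ≤ frobNorm (Z ℓ) / euclNorm u := by
    refine Real.sqrt_le_iff.mpr ⟨div_nonneg (Real.sqrt_nonneg _) hun, ?_⟩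
    rw [div_pow, frob_sq, ← hNdef, fsq, Finset.sum_comm,
      Finset.sum_div]
    refine Finset.sum_le_sum fun k _ => ?_
    have cs := Finset.sum_mul_sq_le_sq_mul_sq Finset.univ u (fun l => Z ℓ l k)
    rw [← hN'] at cs
    rw [hm]
    simp only [div_pow]
    rw [div_le_div_iff₀ (by positivity) hN]
    nlinarith
  set R := P * Z ℓ with hR
  have hrr : euclNorm (R i - R j) ≤ Real.sqrt 2 * frobNorm R := by
    rw [frobNorm, ← Real.sqrt_mul (by norm_num)]
    refine Real.sqrt_le_sqrt ?_
    by_cases hij : i = j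
    · subst hij
      simp
      exact fsq_nonneg R
    · have h1 : ∑ k, R i k ^ 2 + ∑ k, R j k ^ 2 ≤ ∑ a, ∑ k, R a k ^ 2 := by
        rw [← Finset.sum_pair (f := fun a => ∑ k, R a k ^ 2) hij]
        exact Finset.sum_le_sum_of_subset_of_nonneg (Finset.subset_univ _)
          fun a _ _ => by positivity
      have h2 : ∑ k, (R i - R j) k ^ 2 ≤ 2 * (∑ k, R i k ^ 2 + ∑ k, R j k ^ 2) := by
        rw [← Finset.sum_add_distrib, Finset.mul_sum]
        refine Finset.sum_le_sum fun k _ => ?_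
        simp only [Pi.sub_apply]
        nlinarith [sq_nonneg (R i k + R j k)]
      linarith
  have dec : Z ℓ i - Z ℓ j = (u i - u j) • m + (R i - R j) := by
    funext k
    simp only [Pi.sub_apply, Pi.add_apply, Pi.smul_apply, smul_eq_mul, hR, PY, hm]
    ring
  have en : ∀ {q : ℕ} (v : Fin q → ℝ), euclNorm v = ‖WithLp.toLp 2 v‖ := by
    intro q v
    rw [EuclideanSpace.norm_eq]
    simp [euclNorm]
  have tri : euclNorm (Z ℓ i - Z ℓ j) ≤ |u i - u j| * euclNorm m + euclNorm (R i - R j) := by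
    rw [dec, en, en, en, WithLp.toLp_add, WithLp.toLp_smul]
    refine (norm_add_le _ _).trans ?_
    rw [norm_smul, Real.norm_eq_abs]
  have g1 : |u i - u j| * euclNorm m ≤ β ^ ℓ * (frobNorm X / euclNorm u) * |u i - u j| := by
    rw [mul_comm]
    refine mul_le_mul_of_nonneg_right (hmn.trans ?_) (abs_nonneg _)
    rw [← mul_div_assoc]
    exact div_le_div_of_nonneg_right f1 hun
  have g2 := hrr.trans (mul_le_mul_of_nonneg_left f2 (Real.sqrt_nonneg 2))
  rw [← mul_assoc] at g2
  linarith
end
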